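/- arXiv:2605.02876 — 2 statements merged into one kernel-verified Lean document; each statement's English description precedes it below -/
import Mathlib

section
/- For unit vectors n1, n2 ∈ ℝ³ with c = n1·n2, the operators O1 = σ_{n1}⊗σ_{n2}⊗σ_{n2}, O2 = σ_{n2}⊗σ_{n1}⊗σ_{n2}, O3 = σ_{n2}⊗σ_{n2}⊗σ_{n1}, O4 = σ_{n1}⊗σ_{n1}⊗σ_{n1} satisfy the identity O1·O2·O3 + O4 = 2c·(σ_{n1}⊗σ_{n2}⊗σ_{n1}). -/
open Matrix Kronecker
open scoped ComplexOrder

noncomputable section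

/-- Pauli matrices. -/
def σx : Matrix (Fin 2) (Fin 2) ℂ := !![0, 1; 1, 0]
def σy : Matrix (Fin 2) (Fin 2) ℂ := !![0, -Complex.I; Complex.I, 0]
def σz : Matrix (Fin 2) (Fin 2) ℂ := !![1, 0; 0, -1]

/-- Spin observable along direction `n`. -/
def spin (n : Fin 3 → ℝ) : Matrix (Fin 2) (Fin 2) ℂ :=
  (n 0 : ℂ) • σx + (n 1 : ℂ) • σy + (n 2 : ℂ) • σz

/-- Index type for three qubits: `ℂ² ⊗ ℂ² ⊗ ℂ² ≅ ℂ⁸`. -/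
abbrev Q3 := (Fin 2 × Fin 2) × Fin 2

/-- `n` is a unit vector in `ℝ³`. -/
def IsUnitVec (n : Fin 3 → ℝ) : Prop := n 0 ^ 2 + n 1 ^ 2 + n 2 ^ 2 = 1

/-- Euclidean dot product on `ℝ³`. -/
def dot3 (a b : Fin 3 → ℝ) : ℝ := a 0 * b 0 + a 1 * b 1 + a 2 * b 2

def O1 (n1 n2 : Fin 3 → ℝ) : Matrix Q3 Q3 ℂ := spin n1 ⊗ₖ spin n2 ⊗ₖ spin n2
def O2 (n1 n2 : Fin 3 → ℝ) : Matrix Q3 Q3 ℂ := spin n2 ⊗ₖ spin n1 ⊗ₖ spin n2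
def O3 (n1 n2 : Fin 3 → ℝ) : Matrix Q3 Q3 ℂ := spin n2 ⊗ₖ spin n2 ⊗ₖ spin n1
def O4 (n1 n2 : Fin 3 → ℝ) : Matrix Q3 Q3 ℂ := spin n1 ⊗ₖ spin n1 ⊗ₖ spin n1

/-- The functional `I(n1,n2;ρ) = e₄ − e₁e₂e₃` with `eᵢ = Re Tr(Oᵢ ρ)`. -/
def Ifun (n1 n2 : Fin 3 → ℝ) (ρ : Matrix Q3 Q3 ℂ) : ℝ :=
  ((O4 n1 n2 * ρ).trace).re -
    ((O1 n1 n2 * ρ).trace).re * ((O2 n1 n2 * ρ).trace).re * ((O3 n1 n2 * ρ).trace).re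

/-- Computational basis state `|ijk⟩` of three qubits. -/
def ket (i j k : Fin 2) : Q3 → ℂ := fun p => if p = ((i, j), k) then 1 else 0

/-- Expectation value `Re ⟨ψ, M ψ⟩` of an observable `M` in a pure state `ψ`. -/
def eexp (M : Matrix Q3 Q3 ℂ) (ψ : Q3 → ℂ) : ℝ := (star ψ ⬝ᵥ M.mulVec ψ).re

/-- The functional `I` evaluated on a pure state `ρ = ψψ†`. -/
def Ipure (n1 n2 : Fin 3 → ℝ) (ψ : Q3 → ℂ) : ℝ :=
  eexp (O4 n1 n2) ψ - eexp (O1 n1 n2) ψ * eexp (O2 n1 n2) ψ * eexp (O3 n1 n2) ψ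

/-- Anticommutation relation of spin observables. -/
theorem spin_mul_spin_add (a b : Fin 3 → ℝ) :
    spin a * spin b + spin b * spin a = (2 * (dot3 a b : ℂ)) • 1 := by
  ext i j
  fin_cases i <;> fin_cases j <;>
    simp [spin, σx, σy, σz, dot3] <;>
    grind [Complex.I_mul_I]

theorem spin_mul_self {n : Fin 3 → ℝ} (h : IsUnitVec n) : spin n * spin n = 1 := by
  have hn : dot3 n n = 1 := by simpa only [dot3, IsUnitVec, sq] using h
  have key := spin_mul_spin_add n n
  rw [hn, Complex.ofReal_one, mul_one, ← two_smul ℂ (spin n * spin n)] at key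
  exact smul_right_injective _ (two_ne_zero (α := ℂ)) key

theorem spin_mul_spin_mul_spin (a : Fin 3 → ℝ) {b : Fin 3 → ℝ} (h : IsUnitVec b) :
    spin b * spin a * spin b = (2 * (dot3 a b : ℂ)) • spin b - spin a := by
  rw [eq_sub_of_add_eq' (spin_mul_spin_add a b), sub_mul, mul_assoc, spin_mul_self h,
    smul_mul_assoc, one_mul, mul_one]

theorem O1_O2_O3_plus_O4 (n1 n2 : Fin 3 → ℝ) (h1 : IsUnitVec n1) (h2 : IsUnitVec n2) :
    O1 n1 n2 * O2 n1 n2 * O3 n1 n2 + O4 n1 n2 =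
      (2 * (dot3 n1 n2 : ℂ)) • (spin n1 ⊗ₖ spin n2 ⊗ₖ spin n1) := by
  simp only [O1, O2, O3, O4, ← mul_kronecker_mul]
  rw [spin_mul_spin_mul_spin n1 h2, mul_assoc (spin n1), spin_mul_self h2, mul_one, one_mul,
    ← add_kronecker, ← kronecker_add, sub_add_cancel, kronecker_smul, smul_kronecker]
end
end

section
/- For every state in the Acín canonical form ψ = λ0|000⟩ + λ1·e^{iφ}|100⟩ + λ2|101⟩ + λ3|110⟩ + λ4|111⟩ with λ0,…,λ4 ≥ 0, λ0² + λ1² + λ2² + λ3² + λ4² = 1 and φ ∈ ℝ, the functional at the directions n1 = x̂, n2 = ŷ has the closed form I(x̂,ŷ;ψψ†) = 2·λ0·λ4·(4·(λ0·λ4)² + 1). -/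
open Matrix Kronecker
open scoped ComplexOrder

noncomputable section

/-- A three-qubit pure state in the Acín canonical form. -/
def acin (l0 l1 l2 l3 l4 φ : ℝ) : Q3 → ℂ :=
  (l0 : ℂ) • ket 0 0 0 + ((l1 : ℂ) * Complex.exp (Complex.I * φ)) • ket 1 0 0 +
    (l2 : ℂ) • ket 1 0 1 + (l3 : ℂ) • ket 1 1 0 + (l4 : ℂ) • ket 1 1 1

lemma spin_x : spin ![1, 0, 0] = σx := by simp [spin]

lemma spin_y : spin ![0, 1, 0] = σy := by simp [spin]

lemma eexp_kronecker_acin (A B C : Matrix (Fin 2) (Fin 2) ℂ) (l0 l1 l2 l3 l4 φ : ℝ)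
    (hA : A 0 0 = 0 ∧ A 1 1 = 0) (hB : B 0 0 = 0 ∧ B 1 1 = 0) (hC : C 0 0 = 0 ∧ C 1 1 = 0) :
    eexp (A ⊗ₖ B ⊗ₖ C) (acin l0 l1 l2 l3 l4 φ) =
      l0 * l4 * (A 0 1 * B 0 1 * C 0 1 + A 1 0 * B 1 0 * C 1 0).re := by
  obtain ⟨hA0, hA1⟩ := hA
  obtain ⟨hB0, hB1⟩ := hB
  obtain ⟨hC0, hC1⟩ := hC
  rw [← Complex.re_ofReal_mul]
  unfold eexp
  congr 1
  simp [acin, ket, dotProduct, mulVec, Fintype.sum_prod_type, hA0, hA1, hB0, hB1, hC0, hC1]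
  ring

theorem acin_I_closed_form (l0 l1 l2 l3 l4 φ : ℝ)
    (h0 : 0 ≤ l0) (h1 : 0 ≤ l1) (h2 : 0 ≤ l2) (h3 : 0 ≤ l3) (h4 : 0 ≤ l4)
    (hnorm : l0 ^ 2 + l1 ^ 2 + l2 ^ 2 + l3 ^ 2 + l4 ^ 2 = 1) :
    Ipure ![1, 0, 0] ![0, 1, 0] (acin l0 l1 l2 l3 l4 φ) =
      2 * l0 * l4 * (4 * (l0 * l4) ^ 2 + 1) := by
  simp only [Ipure, O1, O2, O3, O4, spin_x, spin_y]
  rw [eexp_kronecker_acin, eexp_kronecker_acin, eexp_kronecker_acin, eexp_kronecker_acin] <;>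
    simp [σx, σy]
  ring
end
end
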